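/- Let D be a Γ-invariant linear operator on compactly supported sections of finite propagation speed, and let (Γ_j) be a tower in Γ. Then there is a sequence c_j > 0 tending to 0 such that |tr e^{zD_{Γ_j}}/[Γ:Γ_j] − tr_Γ e^{zD}| ≤ c_j·|z| for all z ∈ ℂ with |z| ≤ 1 and all j ∈ ℕ. -/

import Mathlib

open scoped BigOperators
open Filter

noncomputable section

variable {Y Γ V : Type*}

section Defs

variable [Group Γ] [MulAction Γ Y]
variable [NormedAddCommGroup V] [InnerProductSpace ℂ V]

/-- The action of `γ ∈ Γ` on compactly (= finitely) supported sections
`φ : Y →₀ V`, given by `(γ · φ)(y) = ρ(γ) φ(γ⁻¹ • y)`. -/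
def secAct (ρ : Γ →* (V ≃ₗᵢ[ℂ] V)) (γ : Γ) (φ : Y →₀ V) : Y →₀ V :=
  Finsupp.equivMapDomain (MulAction.toPerm γ) (φ.mapRange (ρ γ) ((ρ γ).map_zero))

/-- A linear operator on compactly supported sections is `Γ`-invariant if it
commutes with the action of `Γ`. -/
def IsEquivariantOp (ρ : Γ →* (V ≃ₗᵢ[ℂ] V)) (D : (Y →₀ V) →ₗ[ℂ] (Y →₀ V)) : Prop :=
  ∀ (γ : Γ) (φ : Y →₀ V), D (secAct ρ γ φ) = secAct ρ γ (D φ)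

/-- The kernel `⟨x|D|y⟩ ∈ End(V)` of an operator `D`, characterized by
`⟨x|D|y⟩ v = (D δ_{y,v})(x)`. -/
def kernelOf (D : (Y →₀ V) →ₗ[ℂ] (Y →₀ V)) (x y : Y) : V →ₗ[ℂ] V :=
  (Finsupp.lapply x) ∘ₗ D ∘ₗ (Finsupp.lsingle y)

/-- `D` has finite propagation speed `≤ R`:
`supp (Dφ) ⊆ U_R(supp φ) = {x | ∃ y ∈ supp φ, d(x,y) ≤ R}`. -/
def HasPropSpeed [MetricSpace Y] (D : (Y →₀ V) →ₗ[ℂ] (Y →₀ V)) (R : ℝ) : Prop :=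
  ∀ (φ : Y →₀ V) (x : Y), D φ x ≠ 0 → ∃ y ∈ φ.support, dist x y ≤ R

/-- A set of representatives of the orbits of a group `G` acting on `Y`:
it contains exactly one point of every orbit. -/
def IsRepSet (G : Type*) [Group G] [MulAction G Y] (S : Set Y) : Prop :=
  ∀ y : Y, ∃! s, s ∈ S ∧ s ∈ MulAction.orbit G y

/-- The space `W_{Γ'}` of `Γ'`-equivariant functions `f : Y → V`,
i.e. `f(γ • y) = ρ(γ) f(y)` for all `γ ∈ Γ'`. -/
def equivSubmodule (ρ : Γ →* (V ≃ₗᵢ[ℂ] V)) (Γ' : Subgroup Γ) : Submodule ℂ (Y → V) where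
  carrier := {f | ∀ (γ : Γ') (y : Y), f ((γ : Γ) • y) = ρ (γ : Γ) (f y)}
  add_mem' := by intro f g hf hg γ y; simp only [Pi.add_apply, hf γ y, hg γ y, map_add]
  zero_mem' := by intro γ y; simp
  smul_mem' := by intro c f hf γ y; simp only [Pi.smul_apply, hf γ y, map_smul]

/-- The summation map `S_{Γ'} φ (y) = Σ_{γ ∈ Γ'} ρ(γ)⁻¹ φ(γ • y)`. -/
def smap (ρ : Γ →* (V ≃ₗᵢ[ℂ] V)) (Γ' : Subgroup Γ) (φ : Y →₀ V) : Y → V :=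
  fun y => ∑ᶠ γ : Γ', ρ ((γ : Γ)⁻¹) (φ ((γ : Γ) • y))

/-- `DG` is the pushdown of `D` to `W_{Γ'}`, i.e. `DG ∘ S_{Γ'} = S_{Γ'} ∘ D`. -/
def IsPushdown (ρ : Γ →* (V ≃ₗᵢ[ℂ] V)) (Γ' : Subgroup Γ)
    (D : (Y →₀ V) →ₗ[ℂ] (Y →₀ V))
    (DG : equivSubmodule (Y := Y) ρ Γ' →ₗ[ℂ] equivSubmodule (Y := Y) ρ Γ') : Prop :=
  ∀ (w : equivSubmodule (Y := Y) ρ Γ') (φ : Y →₀ V),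
    (w : Y → V) = smap ρ Γ' φ → ((DG w : Y → V) = smap ρ Γ' (D φ))

/-- The kernel `⟨x|D|y⟩`, as a continuous linear map on `V`. -/
def kernelOfL [FiniteDimensional ℂ V] (D : (Y →₀ V) →ₗ[ℂ] (Y →₀ V)) (x y : Y) : V →L[ℂ] V :=
  LinearMap.toContinuousLinearMap (kernelOf D x y)

/-- The heat kernel `⟨x|e^{zD}|y⟩ = Σ_{n ≥ 0} (zⁿ/n!) ⟨x|Dⁿ|y⟩`. -/
def heatKer [FiniteDimensional ℂ V] (D : (Y →₀ V) →ₗ[ℂ] (Y →₀ V)) (z : ℂ) (x y : Y) :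
    V →L[ℂ] V :=
  ∑' n : ℕ, (z ^ n / (n.factorial : ℂ)) • kernelOfL (D ^ n) x y

/-- The `Γ`-trace `tr_Γ e^{zD} = Σ_{s ∈ S} tr ⟨s|e^{zD}|s⟩`,
for a set `S` of representatives of the `Γ`-orbits. -/
def trGammaHeat [FiniteDimensional ℂ V] (D : (Y →₀ V) →ₗ[ℂ] (Y →₀ V)) (z : ℂ)
    (S : Set Y) : ℂ :=
  ∑ᶠ s ∈ S, LinearMap.trace ℂ V ((heatKer D z s s : V →L[ℂ] V) : V →ₗ[ℂ] V)

/-- `tr e^{zT}` for an endomorphism `T` of a finite dimensional space,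
via the exponential series `Σ_{n ≥ 0} (zⁿ/n!) tr(Tⁿ)`. -/
def trExp {W : Type*} [AddCommGroup W] [Module ℂ W] (T : W →ₗ[ℂ] W) (z : ℂ) : ℂ :=
  ∑' n : ℕ, z ^ n / (n.factorial : ℂ) * LinearMap.trace ℂ W (T ^ n)

end Defs

section Helpers

/-- The `ℓ¹`-norm of a finitely supported section. -/
def l1Norm [NormedAddCommGroup V] (φ : Y →₀ V) : ℝ := ∑' x, ‖φ x‖

section Norm

variable [NormedAddCommGroup V]

lemma summable_norm_finsupp (φ : Y →₀ V) : Summable fun x => ‖φ x‖ :=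
  summable_of_hasFiniteSupport <| φ.hasFiniteSupport.subset fun x hx => by
    simpa using hx

lemma norm_apply_le_l1Norm (φ : Y →₀ V) (y : Y) : ‖φ y‖ ≤ l1Norm φ :=
  (summable_norm_finsupp φ).le_tsum y fun _ _ => norm_nonneg _

lemma l1Norm_nonneg (φ : Y →₀ V) : 0 ≤ l1Norm φ := tsum_nonneg fun _ => norm_nonneg _

lemma l1Norm_single (y : Y) (v : V) : l1Norm (Finsupp.single y v) = ‖v‖ := by
  unfold l1Norm
  rw [tsum_eq_single y]
  · simp
  · intro x hx
    simp [Finsupp.single_eq_of_ne hx]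

lemma l1Norm_eq_sum (φ : Y →₀ V) : l1Norm φ = ∑ x ∈ φ.support, ‖φ x‖ :=
  tsum_eq_sum fun x hx => by simpa using hx

lemma l1Norm_add_le (φ ψ : Y →₀ V) : l1Norm (φ + ψ) ≤ l1Norm φ + l1Norm ψ := by
  unfold l1Norm
  rw [← (summable_norm_finsupp φ).tsum_add (summable_norm_finsupp ψ)]
  exact (summable_norm_finsupp _).tsum_le_tsum (fun x => norm_add_le _ _)
    ((summable_norm_finsupp φ).add (summable_norm_finsupp ψ))

lemma l1Norm_sum_le {ι : Type*} (A : Finset ι) (φ : ι → Y →₀ V) :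
    l1Norm (∑ i ∈ A, φ i) ≤ ∑ i ∈ A, l1Norm (φ i) :=
  Finset.le_sum_of_subadditive l1Norm (by simp [l1Norm]) l1Norm_add_le A φ

lemma l1Norm_smul [NormedSpace ℂ V] (c : ℂ) (φ : Y →₀ V) : l1Norm (c • φ) = ‖c‖ * l1Norm φ := by
  simp [l1Norm, norm_smul, tsum_mul_left]

end Norm

section Action

variable [Group Γ] [MulAction Γ Y] [NormedAddCommGroup V] [InnerProductSpace ℂ V]

lemma secAct_apply (ρ : Γ →* (V ≃ₗᵢ[ℂ] V)) (γ : Γ) (φ : Y →₀ V) (y : Y) :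
    secAct ρ γ φ y = ρ γ (φ (γ⁻¹ • y)) := by
  simp [secAct]

lemma rep_mul_apply (ρ : Γ →* (V ≃ₗᵢ[ℂ] V)) (a b : Γ) (v : V) : ρ (a * b) v = ρ a (ρ b v) := by
  rw [map_mul]
  rfl

lemma rep_apply_inv_self (ρ : Γ →* (V ≃ₗᵢ[ℂ] V)) (γ : Γ) (v : V) : ρ γ (ρ γ⁻¹ v) = v := by
  simp

lemma secAct_single (ρ : Γ →* (V ≃ₗᵢ[ℂ] V)) (γ : Γ) (y : Y) (v : V) :
    secAct ρ γ (Finsupp.single y (ρ γ⁻¹ v)) = Finsupp.single (γ • y) v := by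
  simp [secAct]

lemma l1Norm_secAct (ρ : Γ →* (V ≃ₗᵢ[ℂ] V)) (γ : Γ) (φ : Y →₀ V) :
    l1Norm (secAct ρ γ φ) = l1Norm φ := by
  simp only [l1Norm, secAct_apply, LinearIsometryEquiv.norm_map]
  exact (MulAction.toPerm γ⁻¹ : Equiv.Perm Y).tsum_eq fun y => ‖φ y‖

lemma IsEquivariantOp.pow {ρ : Γ →* (V ≃ₗᵢ[ℂ] V)} {D : (Y →₀ V) →ₗ[ℂ] (Y →₀ V)}
    (hD : IsEquivariantOp ρ D) (n : ℕ) : IsEquivariantOp ρ (D ^ n) := by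
  induction n with
  | zero => intro γ φ; rfl
  | succ n ih =>
    intro γ φ
    rw [pow_succ', Module.End.mul_apply, Module.End.mul_apply, ih, hD]

lemma IsPushdown.pow {ρ : Γ →* (V ≃ₗᵢ[ℂ] V)} {Γ' : Subgroup Γ}
    {D : (Y →₀ V) →ₗ[ℂ] (Y →₀ V)}
    {T : equivSubmodule (Y := Y) ρ Γ' →ₗ[ℂ] equivSubmodule (Y := Y) ρ Γ'}
    (hT : IsPushdown ρ Γ' D T) (n : ℕ) : IsPushdown ρ Γ' (D ^ n) (T ^ n) := by
  induction n with
  | zero => intro w φ h; exact h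
  | succ n ih =>
    intro w φ h
    rw [pow_succ', pow_succ', Module.End.mul_apply, Module.End.mul_apply]
    exact hT _ _ (ih w φ h)

lemma IsRepSet.finite {S : Set Y} (hS : IsRepSet Γ S)
    [Finite (MulAction.orbitRel.Quotient Γ Y)] : S.Finite := by
  refine Set.Finite.of_injOn (t := Set.univ)
    (f := fun y => (Quotient.mk'' y : MulAction.orbitRel.Quotient Γ Y))
    (fun _ _ => Set.mem_univ _) ?_ Set.finite_univ
  intro a ha b hb hab
  have h : a ∈ MulAction.orbit Γ b := by
    rw [← MulAction.orbitRel_apply]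
    exact Quotient.exact hab
  exact (hS b).unique ⟨ha, h⟩ ⟨hb, MulAction.mem_orbit_self b⟩

lemma IsRepSet.exists_smul_eq {S : Set Y} (hS : IsRepSet Γ S) (y : Y) :
    ∃ g : Γ, ∃ s ∈ S, g • s = y := by
  obtain ⟨s, ⟨hs, h⟩, -⟩ := hS y
  obtain ⟨g, hg⟩ := MulAction.orbit_eq_iff.mpr h ▸ MulAction.mem_orbit_self y
  exact ⟨g, s, hs, hg⟩

lemma IsRepSet.eq_of_smul_eq {S : Set Y} (hS : IsRepSet Γ S) {s t : Y} (hs : s ∈ S) (ht : t ∈ S)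
    {g : Γ} (h : g • s = t) : s = t :=
  (hS s).unique ⟨hs, MulAction.mem_orbit_self s⟩ ⟨ht, g, h⟩

lemma smul_left_injective_of_free (hfree : ∀ (γ : Γ) (y : Y), γ • y = y → γ = 1) (y : Y) :
    Function.Injective fun γ : Γ => γ • y := by
  intro a b hab
  have h : (b⁻¹ * a) • y = y := by
    rw [mul_smul, inv_smul_eq_iff]; exact hab
  exact (inv_mul_eq_one.mp (hfree _ _ h)).symm

/-- A `Γ`-invariant operator with finitely many orbits is bounded for the `ℓ¹`-norm. -/
lemma IsEquivariantOp.exists_l1Norm_le [FiniteDimensional ℂ V] {ρ : Γ →* (V ≃ₗᵢ[ℂ] V)}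
    {D : (Y →₀ V) →ₗ[ℂ] (Y →₀ V)} (hD : IsEquivariantOp ρ D) {S : Set Y} (hS : IsRepSet Γ S)
    (hfin : S.Finite) : ∃ M : ℝ, 0 ≤ M ∧ ∀ φ, l1Norm (D φ) ≤ M * l1Norm φ := by
  classical
  let b := stdOrthonormalBasis ℂ V
  let M : ℝ := ∑ s ∈ hfin.toFinset, ∑ i, l1Norm (D (Finsupp.single s (b i)))
  have hM0 : 0 ≤ M := Finset.sum_nonneg fun s _ => Finset.sum_nonneg fun i _ => l1Norm_nonneg _
  have hrep : ∀ s ∈ S, ∀ v : V, l1Norm (D (Finsupp.single s v)) ≤ M * ‖v‖ := by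
    intro s hs v
    have hv : D (Finsupp.single s v) = ∑ i, inner ℂ (b i) v • D (Finsupp.single s (b i)) := by
      conv_lhs => rw [← b.sum_repr' v]
      rw [← Finsupp.lsingle_apply (R := ℂ), map_sum, map_sum]
      simp only [map_smul, Finsupp.lsingle_apply]
    rw [hv]
    calc _ ≤ ∑ i, l1Norm (inner ℂ (b i) v • D (Finsupp.single s (b i))) := l1Norm_sum_le _ _
      _ ≤ ∑ i, l1Norm (D (Finsupp.single s (b i))) * ‖v‖ := by
        refine Finset.sum_le_sum fun i _ => ?_
        rw [l1Norm_smul, mul_comm]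
        refine mul_le_mul_of_nonneg_left ?_ (l1Norm_nonneg _)
        simpa using norm_inner_le_norm (𝕜 := ℂ) (b i) v
      _ ≤ M * ‖v‖ := by
        rw [← Finset.sum_mul]
        refine mul_le_mul_of_nonneg_right ?_ (norm_nonneg _)
        exact Finset.single_le_sum
          (f := fun s => ∑ i, l1Norm (D (Finsupp.single s (b i))))
          (fun s _ => Finset.sum_nonneg fun i _ => l1Norm_nonneg _) (hfin.mem_toFinset.mpr hs)
  have hsingle : ∀ (y : Y) (v : V), l1Norm (D (Finsupp.single y v)) ≤ M * ‖v‖ := by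
    intro y v
    obtain ⟨g, s, hs, rfl⟩ := hS.exists_smul_eq y
    rw [← secAct_single ρ, hD, l1Norm_secAct]
    simpa using hrep s hs (ρ g⁻¹ v)
  refine ⟨M, hM0, fun φ => ?_⟩
  conv_lhs => rw [← φ.sum_single, Finsupp.sum, map_sum]
  rw [l1Norm_eq_sum φ, Finset.mul_sum]
  exact (l1Norm_sum_le _ _).trans (Finset.sum_le_sum fun y _ => hsingle _ _)

lemma l1Norm_pow_le {D : (Y →₀ V) →ₗ[ℂ] (Y →₀ V)} {M : ℝ} (hM : 0 ≤ M)
    (hD : ∀ φ, l1Norm (D φ) ≤ M * l1Norm φ) (n : ℕ) (φ : Y →₀ V) :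
    l1Norm ((D ^ n) φ) ≤ M ^ n * l1Norm φ := by
  induction n with
  | zero => simp
  | succ n ih =>
    rw [pow_succ', Module.End.mul_apply, pow_succ', mul_assoc]
    exact (hD _).trans (mul_le_mul_of_nonneg_left ih hM)

lemma smap_support_finite (hfree : ∀ (γ : Γ) (y : Y), γ • y = y → γ = 1)
    (ρ : Γ →* (V ≃ₗᵢ[ℂ] V)) (Γ' : Subgroup Γ) (φ : Y →₀ V) (y : Y) :
    (Function.support fun γ : Γ' => ρ ((γ : Γ)⁻¹) (φ ((γ : Γ) • y))).Finite := by
  refine (φ.hasFiniteSupport.preimage (f := fun γ : Γ' => (γ : Γ) • y)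
    (((smul_left_injective_of_free hfree y).comp Subtype.val_injective).injOn)).subset ?_
  intro γ hγ
  simp only [Function.mem_support, ne_eq, LinearIsometryEquiv.map_eq_zero_iff] at hγ
  exact hγ

/-- The value at `y` of the summation map, as a linear map. -/
def smapAt (hfree : ∀ (γ : Γ) (y : Y), γ • y = y → γ = 1)
    (ρ : Γ →* (V ≃ₗᵢ[ℂ] V)) (Γ' : Subgroup Γ) (y : Y) : (Y →₀ V) →ₗ[ℂ] V where
  toFun φ := smap ρ Γ' φ y
  map_add' φ ψ := by
    simp only [smap, Finsupp.add_apply, map_add]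
    exact finsum_add_distrib (smap_support_finite hfree ρ Γ' φ y)
      (smap_support_finite hfree ρ Γ' ψ y)
  map_smul' c φ := by
    simp only [smap, Finsupp.smul_apply, map_smul, RingHom.id_apply]
    rw [smul_finsum]

lemma smap_mem (ρ : Γ →* (V ≃ₗᵢ[ℂ] V)) (Γ' : Subgroup Γ) (φ : Y →₀ V) :
    smap ρ Γ' φ ∈ equivSubmodule ρ Γ' := by
  intro δ y
  have h : ∀ f : Γ' → V, ρ (δ : Γ) (∑ᶠ γ, f γ) = ∑ᶠ γ, ρ (δ : Γ) (f γ) := fun f =>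
    (ρ (δ : Γ)).toLinearEquiv.toAddEquiv.map_finsum f
  simp only [smap]
  rw [h, eq_comm, ← finsum_comp_equiv (Equiv.mulRight δ)]
  refine finsum_congr fun γ => ?_
  rw [Equiv.coe_mulRight, Subgroup.coe_mul, mul_inv_rev, rep_mul_apply,
    rep_apply_inv_self, mul_smul]

lemma smap_secAct (ρ : Γ →* (V ≃ₗᵢ[ℂ] V)) (Γ' : Subgroup Γ) [Γ'.Normal] (g : Γ) (φ : Y →₀ V)
    (y : Y) : smap ρ Γ' (secAct ρ g φ) (g • y) = ρ g (smap ρ Γ' φ y) := by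
  have h : ∀ f : Γ' → V, ρ g (∑ᶠ γ, f γ) = ∑ᶠ γ, ρ g (f γ) := fun f =>
    (ρ g).toLinearEquiv.toAddEquiv.map_finsum f
  simp only [smap]
  rw [h, ← finsum_comp_equiv (MulAut.conjNormal g : Γ' ≃* Γ').toEquiv]
  refine finsum_congr fun γ => ?_
  simp only [MulEquiv.toEquiv_eq_coe, EquivLike.coe_coe, MulAut.conjNormal_apply, secAct_apply]
  simp only [← rep_mul_apply, smul_smul]
  have h₁ : (g * (γ : Γ) * g⁻¹)⁻¹ * g = g * (γ : Γ)⁻¹ := by group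
  have h₂ : g⁻¹ * (g * (γ : Γ) * g⁻¹ * g) = γ := by group
  rw [h₁, h₂]

lemma norm_smap_le (hfree : ∀ (γ : Γ) (y : Y), γ • y = y → γ = 1)
    (ρ : Γ →* (V ≃ₗᵢ[ℂ] V)) (Γ' : Subgroup Γ) (φ : Y →₀ V) (y : Y) :
    ‖smap ρ Γ' φ y‖ ≤ l1Norm φ := by
  have hinj : Function.Injective fun γ : Γ' => (γ : Γ) • y :=
    (smul_left_injective_of_free hfree y).comp Subtype.val_injective
  rw [smap, finsum_eq_sum _ (smap_support_finite hfree ρ Γ' φ y)]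
  refine (norm_sum_le _ _).trans ?_
  simp only [LinearIsometryEquiv.norm_map]
  have hs : Summable fun γ : Γ' => ‖φ ((γ : Γ) • y)‖ :=
    (summable_norm_finsupp φ).comp_injective hinj
  refine (hs.sum_le_tsum _ fun _ _ => norm_nonneg _).trans ?_
  exact tsum_comp_le_tsum_of_inj (summable_norm_finsupp φ) (fun _ => norm_nonneg _) hinj

lemma smap_eq_self (ρ : Γ →* (V ≃ₗᵢ[ℂ] V)) (Γ' : Subgroup Γ) (φ : Y →₀ V) (y : Y)
    (h : ∀ γ ∈ Γ', γ ≠ 1 → φ (γ • y) = 0) : smap ρ Γ' φ y = φ y := by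
  rw [smap, finsum_eq_single _ 1]
  · simp
  · intro γ hγ
    rw [h γ γ.2 (by simpa using hγ), map_zero]

lemma smap_single_self (hfree : ∀ (γ : Γ) (y : Y), γ • y = y → γ = 1)
    (ρ : Γ →* (V ≃ₗᵢ[ℂ] V)) (Γ' : Subgroup Γ) (y : Y) (v : V) :
    smap ρ Γ' (Finsupp.single y v) y = v := by
  rw [smap_eq_self, Finsupp.single_eq_same]
  intro γ _ hγ
  exact Finsupp.single_eq_of_ne fun h => hγ (hfree γ y h)

lemma smap_single_of_not_mem_orbit (ρ : Γ →* (V ≃ₗᵢ[ℂ] V)) (Γ' : Subgroup Γ) (x y : Y) (v : V)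
    (h : ∀ γ ∈ Γ', γ • y ≠ x) : smap ρ Γ' (Finsupp.single x v) y = 0 := by
  rw [smap]
  refine finsum_eq_zero_of_forall_eq_zero fun γ => ?_
  rw [Finsupp.single_eq_of_ne (h γ γ.2), map_zero]

/-- Along a tower, the summation maps eventually reproduce a finitely supported section. -/
lemma eventually_smap_eq (hfree : ∀ (γ : Γ) (y : Y), γ • y = y → γ = 1)
    (ρ : Γ →* (V ≃ₗᵢ[ℂ] V)) {Γs : ℕ → Subgroup Γ} (hanti : Antitone Γs)
    (hinter : (⨅ j, Γs j) = ⊥) (φ : Y →₀ V) (y : Y) :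
    ∀ᶠ j in atTop, smap ρ (Γs j) φ y = φ y := by
  have hfin : {γ : Γ | φ (γ • y) ≠ 0}.Finite :=
    φ.hasFiniteSupport.preimage (f := fun γ : Γ => γ • y)
      (smul_left_injective_of_free hfree y).injOn
  have hev : ∀ᶠ j in atTop, ∀ γ ∈ {γ : Γ | φ (γ • y) ≠ 0}, γ ∈ Γs j → γ = 1 := by
    rw [eventually_all_finite hfin]
    intro γ _
    by_cases hγ : γ = 1
    · exact Eventually.of_forall fun _ _ => hγ
    · have : γ ∉ ⨅ j, Γs j := by rw [hinter]; simpa using hγ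
      rw [Subgroup.mem_iInf, not_forall] at this
      obtain ⟨k, hk⟩ := this
      filter_upwards [eventually_ge_atTop k] with j hj h
      exact absurd (hanti hj h) hk
  filter_upwards [hev] with j hj
  refine smap_eq_self ρ _ φ y fun γ hγ h1 => ?_
  by_contra h
  exact h1 (hj γ h hγ)

end Action

section Trace

variable [Group Γ] [MulAction Γ Y] [NormedAddCommGroup V] [InnerProductSpace ℂ V]

/-- Restriction of a `Γ'`-equivariant function to representatives of the `Γ'`-orbits. -/
def restrictReps (ρ : Γ →* (V ≃ₗᵢ[ℂ] V)) (Γ' : Subgroup Γ) (S : Set Y) :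
    equivSubmodule (Y := Y) ρ Γ' →ₗ[ℂ] ((Γ ⧸ Γ') × S → V) where
  toFun f p := (f : Y → V) (p.1.out • (p.2 : Y))
  map_add' _ _ := rfl
  map_smul' _ _ := rfl

lemma restrictReps_injective (ρ : Γ →* (V ≃ₗᵢ[ℂ] V)) (Γ' : Subgroup Γ) [Γ'.Normal] {S : Set Y}
    (hS : IsRepSet Γ S) : Function.Injective (restrictReps ρ Γ' S) := by
  rw [injective_iff_map_eq_zero]
  intro f hf
  ext y
  obtain ⟨g, s, hs, rfl⟩ := hS.exists_smul_eq y
  have hmem : g * (g : Γ ⧸ Γ').out⁻¹ ∈ Γ' := by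
    refine Subgroup.Normal.mem_comm inferInstance ?_
    rw [← QuotientGroup.eq]
    exact Quotient.out_eq' _
  have h := f.2 ⟨_, hmem⟩ ((g : Γ ⧸ Γ').out • s)
  have h0 : (f : Y → V) ((g : Γ ⧸ Γ').out • s) = 0 := congrFun hf ((g : Γ ⧸ Γ'), ⟨s, hs⟩)
  simpa [smul_smul, h0] using h

lemma restrictReps_smap_single (hfree : ∀ (γ : Γ) (y : Y), γ • y = y → γ = 1)
    (ρ : Γ →* (V ≃ₗᵢ[ℂ] V)) {Γ' : Subgroup Γ} [Γ'.Normal] {S : Set Y} (hS : IsRepSet Γ S)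
    [DecidableEq ((Γ ⧸ Γ') × S)]
    (p : (Γ ⧸ Γ') × S) (v : V) :
    restrictReps ρ Γ' S ⟨_, smap_mem ρ Γ' (Finsupp.single (p.1.out • (p.2 : Y)) v)⟩ =
      Pi.single p v := by
  ext q
  by_cases hqp : q = p
  · subst hqp
    simpa [restrictReps] using smap_single_self hfree ρ Γ' _ v
  · rw [Pi.single_eq_of_ne hqp]
    refine smap_single_of_not_mem_orbit ρ Γ' _ _ v fun γ hγ h => hqp ?_
    have h' : (p.1.out⁻¹ * γ * q.1.out) • (q.2 : Y) = p.2 := by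
      rw [mul_smul, mul_smul, h, inv_smul_smul]
    have h2 : q.2 = p.2 := Subtype.ext (hS.eq_of_smul_eq q.2.2 p.2.2 h')
    rw [h2] at h'
    have h1 := hfree _ _ h'
    refine Prod.ext ?_ h2
    rw [← Quotient.out_eq' q.1, ← Quotient.out_eq' p.1]
    refine (QuotientGroup.eq.mpr ?_).symm
    rw [eq_inv_of_mul_eq_one_right h1, mul_inv_rev, inv_inv, ← mul_assoc]
    simpa using Subgroup.Normal.conj_mem inferInstance _ (Γ'.inv_mem hγ) p.1.out⁻¹

lemma restrictReps_bijective (hfree : ∀ (γ : Γ) (y : Y), γ • y = y → γ = 1)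
    (ρ : Γ →* (V ≃ₗᵢ[ℂ] V)) (Γ' : Subgroup Γ) [Γ'.Normal] [Γ'.FiniteIndex] {S : Set Y}
    (hS : IsRepSet Γ S) (hfin : S.Finite) : Function.Bijective (restrictReps ρ Γ' S) := by
  classical
  refine ⟨restrictReps_injective ρ Γ' hS, ?_⟩
  have := hfin.fintype
  have := Fintype.ofFinite (Γ ⧸ Γ')
  rw [← LinearMap.range_eq_top, eq_top_iff]
  intro F _
  rw [← Finset.univ_sum_single F]
  refine Submodule.sum_mem _ fun p _ => ?_
  exact ⟨_, restrictReps_smap_single hfree ρ hS p (F p)⟩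

/-- The block of the pushdown of `E` to `Γ'` at the representative `s`. -/
def diagBlock (hfree : ∀ (γ : Γ) (y : Y), γ • y = y → γ = 1) (ρ : Γ →* (V ≃ₗᵢ[ℂ] V))
    (Γ' : Subgroup Γ) (E : (Y →₀ V) →ₗ[ℂ] (Y →₀ V)) (s : Y) : V →ₗ[ℂ] V :=
  smapAt hfree ρ Γ' s ∘ₗ E ∘ₗ Finsupp.lsingle s

lemma diagBlock_apply (hfree : ∀ (γ : Γ) (y : Y), γ • y = y → γ = 1) (ρ : Γ →* (V ≃ₗᵢ[ℂ] V))
    (Γ' : Subgroup Γ) (E : (Y →₀ V) →ₗ[ℂ] (Y →₀ V)) (s : Y) (v : V) :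
    diagBlock hfree ρ Γ' E s v = smap ρ Γ' (E (Finsupp.single s v)) s := rfl

lemma trace_diagBlock_smul (hfree : ∀ (γ : Γ) (y : Y), γ • y = y → γ = 1)
    {ρ : Γ →* (V ≃ₗᵢ[ℂ] V)} (Γ' : Subgroup Γ) [Γ'.Normal] {E : (Y →₀ V) →ₗ[ℂ] (Y →₀ V)}
    (hE : IsEquivariantOp ρ E) (g : Γ) (s : Y) :
    LinearMap.trace ℂ V (diagBlock hfree ρ Γ' E (g • s)) =
      LinearMap.trace ℂ V (diagBlock hfree ρ Γ' E s) := by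
  rw [← LinearMap.trace_conj' (diagBlock hfree ρ Γ' E s) (ρ g).toLinearEquiv]
  congr 1
  ext v
  simp only [diagBlock_apply, LinearEquiv.conj_apply_apply]
  rw [← secAct_single ρ, hE, smap_secAct]
  simp

/-- The trace of a pushdown to a normal subgroup of finite index. -/
lemma IsPushdown.trace_eq [FiniteDimensional ℂ V]
    (hfree : ∀ (γ : Γ) (y : Y), γ • y = y → γ = 1)
    {ρ : Γ →* (V ≃ₗᵢ[ℂ] V)} {Γ' : Subgroup Γ} [Γ'.Normal] [Γ'.FiniteIndex]
    {S : Set Y} (hS : IsRepSet Γ S) (hfin : S.Finite) {E : (Y →₀ V) →ₗ[ℂ] (Y →₀ V)}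
    (hE : IsEquivariantOp ρ E)
    {T : equivSubmodule (Y := Y) ρ Γ' →ₗ[ℂ] equivSubmodule (Y := Y) ρ Γ'}
    (hT : IsPushdown ρ Γ' E T) :
    LinearMap.trace ℂ _ T =
      Γ'.index * ∑ s ∈ hfin.toFinset, LinearMap.trace ℂ V (diagBlock hfree ρ Γ' E s) := by
  classical
  have := hfin.fintype
  have := Fintype.ofFinite (Γ ⧸ Γ')
  let b := stdOrthonormalBasis ℂ V
  let e := LinearEquiv.ofBijective _ (restrictReps_bijective hfree ρ Γ' hS hfin)
  let B := (Pi.basis fun _ : (Γ ⧸ Γ') × S => b.toBasis).map e.symm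
  have hB : ∀ p i, B ⟨p, i⟩ =
      ⟨_, smap_mem ρ Γ' (Finsupp.single (p.1.out • (p.2 : Y)) (b i))⟩ := by
    intro p i
    simp only [B, Module.Basis.map_apply, Pi.basis_apply, OrthonormalBasis.coe_toBasis]
    rw [LinearEquiv.symm_apply_eq]
    exact (restrictReps_smap_single hfree ρ hS p (b i)).symm
  have hrepr : ∀ w p i, B.repr w ⟨p, i⟩ =
      inner ℂ (b i) ((w : Y → V) (p.1.out • (p.2 : Y))) := by
    intro w p i
    simp only [B, Module.Basis.map_repr, LinearEquiv.trans_apply, LinearEquiv.symm_symm,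
      Pi.basis_repr, OrthonormalBasis.coe_toBasis_repr_apply, OrthonormalBasis.repr_apply_apply]
    rfl
  rw [LinearMap.trace_eq_matrix_trace ℂ B, Matrix.trace, Fintype.sum_sigma]
  simp only [Matrix.diag_apply, LinearMap.toMatrix_apply, hB, hrepr]
  have hblock : ∀ p : (Γ ⧸ Γ') × S,
      ∑ i, inner ℂ (b i) ((T ⟨_, smap_mem ρ Γ' (Finsupp.single (p.1.out • (p.2 : Y)) (b i))⟩ :
        Y → V) (p.1.out • (p.2 : Y))) = LinearMap.trace ℂ V (diagBlock hfree ρ Γ' E p.2) := by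
    intro p
    rw [← trace_diagBlock_smul hfree Γ' hE p.1.out, LinearMap.trace_eq_sum_inner _ b]
    refine Finset.sum_congr rfl fun i _ => ?_
    rw [hT _ _ rfl, diagBlock_apply]
  simp only [hblock]
  rw [Fintype.sum_prod_type]
  dsimp only
  rw [Finset.sum_const, Finset.card_univ, ← Nat.card_eq_fintype_card,
    ← Subgroup.index, nsmul_eq_mul, Finset.sum_subtype hfin.toFinset fun _ => hfin.mem_toFinset]

end Trace

section Heat

variable [NormedAddCommGroup V] [InnerProductSpace ℂ V] [FiniteDimensional ℂ V]

lemma summable_mul_pow_div_factorial (C M : ℝ) :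
    Summable fun n : ℕ => C * M ^ n / (n.factorial : ℝ) := by
  simpa only [mul_div_assoc] using (Real.summable_pow_div_factorial M).mul_left C

lemma hasSum_heatKer {D : (Y →₀ V) →ₗ[ℂ] (Y →₀ V)} {M : ℝ} (hM : 0 ≤ M)
    (hD : ∀ φ, l1Norm (D φ) ≤ M * l1Norm φ) (z : ℂ) (x y : Y) :
    HasSum (fun n : ℕ => (z ^ n / (n.factorial : ℂ)) • kernelOfL (D ^ n) x y)
      (heatKer D z x y) := by
  refine Summable.hasSum (.of_norm_bounded
    (Real.summable_pow_div_factorial (‖z‖ * M)) fun n => ?_)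
  have h : ‖kernelOfL (D ^ n) x y‖ ≤ M ^ n := by
    refine ContinuousLinearMap.opNorm_le_bound _ (pow_nonneg hM n) fun v => ?_
    rw [← l1Norm_single y v]
    exact (norm_apply_le_l1Norm _ x).trans (l1Norm_pow_le hM hD n _)
  rw [norm_smul, norm_div, norm_pow, Complex.norm_natCast, mul_pow, mul_div_right_comm]
  exact mul_le_mul_of_nonneg_left h (by positivity)

lemma hasSum_trGammaHeat {D : (Y →₀ V) →ₗ[ℂ] (Y →₀ V)} {M : ℝ} (hM : 0 ≤ M)
    (hD : ∀ φ, l1Norm (D φ) ≤ M * l1Norm φ) (z : ℂ) {S : Set Y} (hfin : S.Finite) :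
    HasSum (fun n : ℕ => z ^ n / (n.factorial : ℂ) *
      ∑ s ∈ hfin.toFinset, LinearMap.trace ℂ V (kernelOf (D ^ n) s s)) (trGammaHeat D z S) := by
  rw [trGammaHeat, finsum_mem_eq_finite_toFinset_sum _ hfin]
  simp only [Finset.mul_sum]
  refine hasSum_sum fun s _ => ?_
  let L : (V →L[ℂ] V) →L[ℂ] ℂ := LinearMap.toContinuousLinearMap
    (LinearMap.trace ℂ V ∘ₗ ContinuousLinearMap.coeLM ℂ)
  have h := (hasSum_heatKer hM hD z s s).mapL L
  simp only [map_smul, smul_eq_mul] at h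
  exact h

end Heat

section Deviation

variable [Group Γ] [MulAction Γ Y] [NormedAddCommGroup V] [InnerProductSpace ℂ V]
  [FiniteDimensional ℂ V]

/-- A bound for the difference between the normalized trace of the pushdown of `E` to `Γ'`
and the `Γ`-trace of `E`. -/
def traceDeviation (ρ : Γ →* (V ≃ₗᵢ[ℂ] V)) (Γ' : Subgroup Γ) (E : (Y →₀ V) →ₗ[ℂ] (Y →₀ V))
    (A : Finset Y) : ℝ :=
  ∑ s ∈ A, ∑ i, ‖smap ρ Γ' (E (Finsupp.single s (stdOrthonormalBasis ℂ V i))) s -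
    E (Finsupp.single s (stdOrthonormalBasis ℂ V i)) s‖

lemma traceDeviation_nonneg (ρ : Γ →* (V ≃ₗᵢ[ℂ] V)) (Γ' : Subgroup Γ)
    (E : (Y →₀ V) →ₗ[ℂ] (Y →₀ V)) (A : Finset Y) : 0 ≤ traceDeviation ρ Γ' E A :=
  Finset.sum_nonneg fun _ _ => Finset.sum_nonneg fun _ _ => norm_nonneg _

lemma traceDeviation_one (hfree : ∀ (γ : Γ) (y : Y), γ • y = y → γ = 1)
    (ρ : Γ →* (V ≃ₗᵢ[ℂ] V)) (Γ' : Subgroup Γ) (A : Finset Y) :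
    traceDeviation ρ Γ' 1 A = 0 := by
  simp [traceDeviation, smap_single_self hfree]

lemma norm_trace_diagBlock_sub_le (hfree : ∀ (γ : Γ) (y : Y), γ • y = y → γ = 1)
    (ρ : Γ →* (V ≃ₗᵢ[ℂ] V)) (Γ' : Subgroup Γ) (E : (Y →₀ V) →ₗ[ℂ] (Y →₀ V)) (A : Finset Y) :
    ‖∑ s ∈ A, LinearMap.trace ℂ V (diagBlock hfree ρ Γ' E s) -
      ∑ s ∈ A, LinearMap.trace ℂ V (kernelOf E s s)‖ ≤ traceDeviation ρ Γ' E A := by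
  rw [← Finset.sum_sub_distrib]
  refine norm_sum_le_of_le _ fun s _ => ?_
  rw [LinearMap.trace_eq_sum_inner _ (stdOrthonormalBasis ℂ V),
    LinearMap.trace_eq_sum_inner _ (stdOrthonormalBasis ℂ V), ← Finset.sum_sub_distrib]
  refine norm_sum_le_of_le _ fun i _ => ?_
  rw [← inner_sub_right]
  refine (norm_inner_le_norm _ _).trans ?_
  rw [OrthonormalBasis.norm_eq_one, one_mul]
  rfl

lemma traceDeviation_pow_le (hfree : ∀ (γ : Γ) (y : Y), γ • y = y → γ = 1)
    (ρ : Γ →* (V ≃ₗᵢ[ℂ] V)) (Γ' : Subgroup Γ) {D : (Y →₀ V) →ₗ[ℂ] (Y →₀ V)} {M : ℝ}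
    (hM : 0 ≤ M) (hD : ∀ φ, l1Norm (D φ) ≤ M * l1Norm φ) (A : Finset Y) (n : ℕ) :
    traceDeviation ρ Γ' (D ^ n) A ≤ (A.card * (Module.finrank ℂ V * 2)) * M ^ n := by
  have h : ∀ (s : Y) (i : Fin (Module.finrank ℂ V)),
      ‖smap ρ Γ' ((D ^ n) (Finsupp.single s (stdOrthonormalBasis ℂ V i))) s -
        (D ^ n) (Finsupp.single s (stdOrthonormalBasis ℂ V i)) s‖ ≤ 2 * M ^ n := by
    intro s i
    have hN := l1Norm_pow_le hM hD n (Finsupp.single s (stdOrthonormalBasis ℂ V i))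
    rw [l1Norm_single, OrthonormalBasis.norm_eq_one, mul_one] at hN
    refine (norm_sub_le _ _).trans ?_
    rw [two_mul]
    exact add_le_add ((norm_smap_le hfree ρ Γ' _ s).trans hN)
      ((norm_apply_le_l1Norm _ s).trans hN)
  calc traceDeviation ρ Γ' (D ^ n) A
      ≤ ∑ s ∈ A, ∑ i : Fin (Module.finrank ℂ V), 2 * M ^ n :=
        Finset.sum_le_sum fun s _ => Finset.sum_le_sum fun i _ => h s i
    _ = _ := by
      simp only [Finset.sum_const, Finset.card_univ, Fintype.card_fin, nsmul_eq_mul]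
      ring

lemma tendsto_traceDeviation (hfree : ∀ (γ : Γ) (y : Y), γ • y = y → γ = 1)
    (ρ : Γ →* (V ≃ₗᵢ[ℂ] V)) {Γs : ℕ → Subgroup Γ} (hanti : Antitone Γs)
    (hinter : (⨅ j, Γs j) = ⊥) (E : (Y →₀ V) →ₗ[ℂ] (Y →₀ V)) (A : Finset Y) :
    Tendsto (fun j => traceDeviation ρ (Γs j) E A) atTop (nhds 0) := by
  have h0 : (0 : ℝ) = ∑ s ∈ A, ∑ i : Fin (Module.finrank ℂ V), 0 := by simp
  rw [h0]
  refine tendsto_finsetSum _ fun s _ => tendsto_finsetSum _ fun i _ => ?_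
  refine tendsto_const_nhds.congr' ?_
  filter_upwards [eventually_smap_eq hfree ρ hanti hinter
    (E (Finsupp.single s (stdOrthonormalBasis ℂ V i))) s] with j hj
  rw [hj, sub_self, norm_zero]

end Deviation

end Helpers

/-- Let `D` be `Γ`-invariant of finite propagation speed and `(Γ_j)` a tower in
`Γ`.  Then there is a sequence `c_j > 0` tending to `0` such that
`|tr e^{zD_{Γ_j}}/[Γ:Γ_j] − tr_Γ e^{zD}| ≤ c_j |z|` for all `|z| ≤ 1` and all `j`. -/
theorem heat_trace_difference_bound
    [MetricSpace Y] [Group Γ] [MulAction Γ Y]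
    [NormedAddCommGroup V] [InnerProductSpace ℂ V] [FiniteDimensional ℂ V]
    (hball : ∀ (y : Y) (R : ℝ), (Metric.closedBall y R).Finite)
    (hiso : ∀ γ : Γ, Isometry (fun y : Y => γ • y))
    (hfree : ∀ (γ : Γ) (y : Y), γ • y = y → γ = 1)
    (horb : Finite (MulAction.orbitRel.Quotient Γ Y))
    (ρ : Γ →* (V ≃ₗᵢ[ℂ] V))
    (D : (Y →₀ V) →ₗ[ℂ] (Y →₀ V))
    (hinv : IsEquivariantOp ρ D)
    (hprop : ∃ R : ℝ, HasPropSpeed D R)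
    (Γs : ℕ → Subgroup Γ) (htop : Γs 0 = ⊤)
    (hdec : ∀ j, Γs (j + 1) ≤ Γs j)
    (hnorm : ∀ j, (Γs j).Normal) (hfi : ∀ j, (Γs j).FiniteIndex)
    (hinter : (⨅ j, Γs j) = ⊥)
    (DG : ∀ j, equivSubmodule (Y := Y) ρ (Γs j) →ₗ[ℂ] equivSubmodule (Y := Y) ρ (Γs j))
    (hDG : ∀ j, IsPushdown ρ (Γs j) D (DG j))
    (S : Set Y) (hS : IsRepSet Γ S) :
    ∃ c : ℕ → ℝ, (∀ j, 0 < c j) ∧ Tendsto c atTop (nhds 0) ∧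
      ∀ (j : ℕ) (z : ℂ), ‖z‖ ≤ 1 →
        ‖trExp (DG j) z / ((Γs j).index : ℂ) - trGammaHeat D z S‖ ≤ c j * ‖z‖ := by
  have hfin : S.Finite := hS.finite
  obtain ⟨M, hM, hD⟩ := hinv.exists_l1Norm_le hS hfin
  have hanti : Antitone Γs := antitone_nat_of_succ_le hdec
  let r : ℕ → ℕ → ℝ := fun j n => traceDeviation ρ (Γs j) (D ^ n) hfin.toFinset
  let C : ℝ := hfin.toFinset.card * (Module.finrank ℂ V * 2)
  have hr0 : ∀ j n, 0 ≤ r j n / (n.factorial : ℝ) := fun j n =>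
    div_nonneg (traceDeviation_nonneg _ _ _ _) (Nat.cast_nonneg _)
  have hrle : ∀ j n, r j n / (n.factorial : ℝ) ≤ C * M ^ n / (n.factorial : ℝ) := fun j n =>
    div_le_div_of_nonneg_right (traceDeviation_pow_le hfree ρ (Γs j) hM hD _ n)
      (Nat.cast_nonneg _)
  have hrsum : ∀ j, Summable fun n => r j n / (n.factorial : ℝ) := fun j =>
    (summable_mul_pow_div_factorial C M).of_nonneg_of_le (hr0 j) (hrle j)
  refine ⟨fun j => ∑' n, r j n / (n.factorial : ℝ) + 1 / ((j : ℝ) + 1),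
    fun j => add_pos_of_nonneg_of_pos (tsum_nonneg (hr0 j)) Nat.one_div_pos_of_nat, ?_, ?_⟩
  · have h : Tendsto (fun j => ∑' n, r j n / (n.factorial : ℝ)) atTop (nhds 0) := by
      rw [← tsum_zero (α := ℝ) (β := ℕ)]
      refine tendsto_tsum_of_dominated_convergence (summable_mul_pow_div_factorial C M)
        (fun n => ?_) (Eventually.of_forall fun j n => ?_)
      · simpa using (tendsto_traceDeviation hfree ρ hanti hinter (D ^ n) hfin.toFinset).div_const
          (n.factorial : ℝ)
      · rw [Real.norm_of_nonneg (hr0 j n)]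
        exact hrle j n
    simpa using h.add tendsto_one_div_add_atTop_nhds_zero_nat
  · intro j z hz
    have := hnorm j
    have := hfi j
    have hidx : ((Γs j).index : ℂ) ≠ 0 := Nat.cast_ne_zero.mpr Subgroup.FiniteIndex.index_ne_zero
    let d : ℕ → ℂ := fun n => z ^ n / (n.factorial : ℂ) *
      (∑ s ∈ hfin.toFinset, LinearMap.trace ℂ V (diagBlock hfree ρ (Γs j) (D ^ n) s) -
        ∑ s ∈ hfin.toFinset, LinearMap.trace ℂ V (kernelOf (D ^ n) s s))
    have hd : ∀ n, ‖d n‖ ≤ r j n / (n.factorial : ℝ) * ‖z‖ := by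
      intro n
      have hle : ‖d n‖ ≤ ‖z‖ ^ n / (n.factorial : ℝ) * r j n := by
        rw [norm_mul, norm_div, norm_pow, Complex.norm_natCast]
        exact mul_le_mul_of_nonneg_left (norm_trace_diagBlock_sub_le hfree ρ (Γs j) (D ^ n) _)
          (by positivity)
      refine hle.trans ?_
      rw [div_mul_comm, mul_comm]
      rcases n with _ | n
      · simp [r, traceDeviation_one hfree]
      · rw [mul_comm]
        exact mul_le_mul_of_nonneg_left
          (pow_le_of_le_one (norm_nonneg z) hz n.succ_ne_zero) (hr0 j _)
    have hbound := (hrsum j).hasSum.mul_right ‖z‖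
    have hdsum : Summable d := .of_norm_bounded hbound.summable hd
    have htr : trExp (DG j) z / ((Γs j).index : ℂ) = trGammaHeat D z S + ∑' n, d n := by
      rw [trExp, ← tsum_div_const]
      refine (tsum_congr fun n => ?_).trans
        ((hasSum_trGammaHeat hM hD z hfin).add hdsum.hasSum).tsum_eq
      rw [((hDG j).pow n).trace_eq hfree hS hfin (hinv.pow n)]
      simp only [d]
      field_simp
      ring
    rw [htr, add_sub_cancel_left]
    refine (tsum_of_norm_bounded hbound hd).trans ?_
    refine mul_le_mul_of_nonneg_right ?_ (norm_nonneg z)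
    exact le_add_of_nonneg_right Nat.one_div_pos_of_nat.le
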